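/- arXiv:1302.5984 — 2 statements merged into one kernel-verified Lean document; each statement's English description precedes it below -/
import Mathlib

section
/- The series ∑_{n=0}^∞ C(4n,2n)² · C(2n,n) · (3 + 26n + 48n² − 96n³)/2^{12n} converges to 2√2/π. -/
open Real Filter

/-- If the termwise difference of two series telescopes with a certificate `G` vanishing at
infinity, then the two sums differ by the boundary term `G 0`. -/
theorem tsum_sub_tsum_eq_of_telescoping {F F' G : ℕ → ℝ} (hF : Summable F) (hF' : Summable F')
    (hG : Tendsto G atTop (nhds 0)) (h : ∀ k, F' k - F k = G (k + 1) - G k) :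
    ∑' k, F k - ∑' k, F' k = G 0 := by
  have h1 := (hF'.sub hF).hasSum.tendsto_sum_nat
  have h2 : Tendsto (fun K => ∑ k ∈ Finset.range K, (F' k - F k)) atTop (nhds (0 - G 0)) := by
    simp only [h, Finset.sum_range_sub]
    exact hG.sub_const _
  have h3 := tendsto_nhds_unique h1 h2
  rw [hF'.tsum_sub hF] at h3
  linarith

/-- The coefficients `(-1/4)_k (1/4)_k / ((n+1)_k)^2`. -/
noncomputable def squareCoeff (n k : ℕ) : ℝ :=
  ∏ j ∈ Finset.range k, ((j : ℝ) ^ 2 - 1 / 16) / ((n : ℝ) + j + 1) ^ 2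

/-- The coefficients `(-1/4)_k (1/4)_k / ((m+1)_k k!)` of a Gauss hypergeometric series. -/
noncomputable def gaussCoeff (m k : ℕ) : ℝ :=
  ∏ j ∈ Finset.range k, ((j : ℝ) ^ 2 - 1 / 16) / (((m : ℝ) + j + 1) * (j + 1))

theorem squareCoeff_succ_right (n k : ℕ) :
    squareCoeff n (k + 1) = squareCoeff n k * (((k : ℝ) ^ 2 - 1 / 16) / ((n : ℝ) + k + 1) ^ 2) :=
  Finset.prod_range_succ _ _

theorem gaussCoeff_succ_right (m k : ℕ) :
    gaussCoeff m (k + 1) =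
      gaussCoeff m k * (((k : ℝ) ^ 2 - 1 / 16) / (((m : ℝ) + k + 1) * (k + 1))) :=
  Finset.prod_range_succ _ _

theorem squareCoeff_succ_left (n k : ℕ) :
    squareCoeff (n + 1) k = squareCoeff n k * (((n : ℝ) + 1) ^ 2 / ((n : ℝ) + k + 1) ^ 2) := by
  induction k with
  | zero =>
    have : (n : ℝ) + 1 ≠ 0 := by positivity
    simp [squareCoeff, this]
  | succ k ih =>
    rw [squareCoeff_succ_right, squareCoeff_succ_right, ih]
    have h1 : (n : ℝ) + k + 1 ≠ 0 := by positivity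
    have h2 : (n : ℝ) + k + 1 + 1 ≠ 0 := by positivity
    have h3 : (n : ℝ) + 1 + k + 1 = n + k + 1 + 1 := by ring
    have h4 : (n : ℝ) + (k + 1) + 1 = n + k + 1 + 1 := by ring
    push_cast
    rw [h3, h4]
    field_simp

theorem gaussCoeff_succ_left (m k : ℕ) :
    gaussCoeff (m + 1) k = gaussCoeff m k * (((m : ℝ) + 1) / ((m : ℝ) + k + 1)) := by
  induction k with
  | zero =>
    have : (m : ℝ) + 1 ≠ 0 := by positivity
    simp [gaussCoeff, this]
  | succ k ih =>
    rw [gaussCoeff_succ_right, gaussCoeff_succ_right, ih]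
    have h1 : (m : ℝ) + k + 1 ≠ 0 := by positivity
    have h2 : (m : ℝ) + k + 1 + 1 ≠ 0 := by positivity
    have h3 : (m : ℝ) + 1 + k + 1 = m + k + 1 + 1 := by ring
    have h4 : (m : ℝ) + (k + 1) + 1 = m + k + 1 + 1 := by ring
    push_cast
    rw [h3, h4]
    field_simp

theorem abs_squareCoeff_zero_le (k : ℕ) : |squareCoeff 0 k| ≤ 1 / ((k : ℝ) + 1) ^ 2 := by
  induction k with
  | zero => simp [squareCoeff]
  | succ k ih =>
    rw [squareCoeff_succ_right, abs_mul]
    have key : |((k : ℝ) ^ 2 - 1 / 16) / (((0 : ℕ) : ℝ) + k + 1) ^ 2| ≤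
        ((k : ℝ) + 1) ^ 2 / ((k : ℝ) + 2) ^ 2 := by
      rw [abs_div, abs_of_pos (show (0 : ℝ) < (((0 : ℕ) : ℝ) + k + 1) ^ 2 by positivity),
        div_le_div_iff₀ (by positivity) (by positivity)]
      have hk : (0 : ℝ) ≤ k := by positivity
      rcases Nat.eq_zero_or_pos k with rfl | hpos
      · norm_num
      · have h1 : (1 : ℝ) ≤ k := by exact_mod_cast hpos
        rw [abs_of_nonneg (by nlinarith)]
        push_cast
        nlinarith [sq_nonneg ((k : ℝ) + 2), mul_nonneg hk hk]
    calc |squareCoeff 0 k| * _ ≤ 1 / ((k : ℝ) + 1) ^ 2 * (((k : ℝ) + 1) ^ 2 / ((k : ℝ) + 2) ^ 2) :=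
          mul_le_mul ih key (abs_nonneg _) (by positivity)
      _ = 1 / (((k + 1 : ℕ) : ℝ) + 1) ^ 2 := by
          push_cast
          have : (k : ℝ) + 1 + 1 = k + 2 := by ring
          rw [this]
          field_simp

theorem abs_squareCoeff_le (n k : ℕ) : |squareCoeff n k| ≤ 1 / ((k : ℝ) + 1) ^ 2 := by
  induction n with
  | zero => exact abs_squareCoeff_zero_le k
  | succ n ih =>
    rw [squareCoeff_succ_left, abs_mul]
    refine (mul_le_of_le_one_right (abs_nonneg _) ?_).trans ih
    rw [abs_of_nonneg (by positivity)]
    refine div_le_one_of_le₀ ?_ (by positivity)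
    gcongr
    linarith [show (0 : ℝ) ≤ k by positivity]

theorem gaussCoeff_zero (k : ℕ) : gaussCoeff 0 k = squareCoeff 0 k := by
  simp [gaussCoeff, squareCoeff, pow_two]

theorem abs_gaussCoeff_le (m k : ℕ) : |gaussCoeff m k| ≤ 1 / ((k : ℝ) + 1) ^ 2 := by
  induction m with
  | zero => rw [gaussCoeff_zero]; exact abs_squareCoeff_zero_le k
  | succ m ih =>
    rw [gaussCoeff_succ_left, abs_mul]
    refine (mul_le_of_le_one_right (abs_nonneg _) ?_).trans ih
    rw [abs_of_nonneg (by positivity)]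
    refine div_le_one_of_le₀ ?_ (by positivity)
    linarith [show (0 : ℝ) ≤ k by positivity]

theorem abs_gaussCoeff_succ_le (m k : ℕ) : |gaussCoeff m (k + 1)| ≤ 1 / ((m : ℝ) + 1) := by
  induction m with
  | zero =>
    refine (abs_gaussCoeff_le 0 (k + 1)).trans ?_
    refine div_le_div_of_nonneg_left zero_le_one (by positivity) ?_
    push_cast
    nlinarith [show (0 : ℝ) ≤ k by positivity]
  | succ m ih =>
    rw [gaussCoeff_succ_left, abs_mul]
    have h : |((m : ℝ) + 1) / ((m : ℝ) + (k + 1 : ℕ) + 1)| ≤ ((m : ℝ) + 1) / ((m : ℝ) + 1 + 1) := by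
      rw [abs_of_nonneg (by positivity)]
      refine div_le_div_of_nonneg_left (by positivity) (by positivity) ?_
      push_cast
      linarith [show (0 : ℝ) ≤ k by positivity]
    calc |gaussCoeff m (k + 1)| * _
        ≤ 1 / ((m : ℝ) + 1) * (((m : ℝ) + 1) / ((m : ℝ) + 1 + 1)) :=
          mul_le_mul ih h (abs_nonneg _) (by positivity)
      _ = 1 / (((m + 1 : ℕ) : ℝ) + 1) := by
          push_cast
          field_simp

theorem summable_one_div_add_one_sq : Summable fun k : ℕ => 1 / ((k : ℝ) + 1) ^ 2 := by
  have h := (summable_nat_add_iff 1).2 (Real.summable_one_div_nat_pow.2 one_lt_two)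
  simpa using h

theorem summable_of_abs_le_one_div_sq {f : ℕ → ℝ} (h : ∀ k : ℕ, |f k| ≤ 1 / ((k : ℝ) + 1) ^ 2) :
    Summable f :=
  Summable.of_norm_bounded summable_one_div_add_one_sq h

theorem tendsto_linear_mul_zero {f : ℕ → ℝ} (h : ∀ k : ℕ, |f k| ≤ 1 / ((k : ℝ) + 1) ^ 2)
    (a b : ℝ) : Tendsto (fun k : ℕ => (a * k + b) * f k) atTop (nhds 0) := by
  have h0 : Tendsto (fun k : ℕ => (|a| + |b|) * (1 / ((k : ℝ) + 1))) atTop (nhds 0) := by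
    simpa using (tendsto_one_div_add_atTop_nhds_zero_nat (𝕜 := ℝ)).const_mul (|a| + |b|)
  refine squeeze_zero_norm (fun k => ?_) h0
  have hk : (0 : ℝ) ≤ k := by positivity
  have h1 : |a * k + b| ≤ (|a| + |b|) * ((k : ℝ) + 1) := by
    refine (abs_add_le _ _).trans ?_
    rw [abs_mul, abs_of_nonneg hk]
    nlinarith [abs_nonneg a, abs_nonneg b, mul_nonneg (abs_nonneg b) hk]
  rw [Real.norm_eq_abs, abs_mul]
  calc |a * k + b| * |f k| ≤ (|a| + |b|) * ((k : ℝ) + 1) * (1 / ((k : ℝ) + 1) ^ 2) :=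
        mul_le_mul h1 (h k) (abs_nonneg _) (by positivity)
    _ = (|a| + |b|) * (1 / ((k : ℝ) + 1)) := by field_simp

theorem tsum_gaussCoeff_succ (m : ℕ) :
    ∑' k, gaussCoeff m k = (1 - (1 / 4) ^ 2 / ((m : ℝ) + 1) ^ 2) * ∑' k, gaussCoeff (m + 1) k := by
  have hs := fun m => summable_of_abs_le_one_div_sq (abs_gaussCoeff_le m)
  have h := tsum_sub_tsum_eq_of_telescoping (hs m)
    ((hs (m + 1)).mul_left (1 - (1 / 4) ^ 2 / ((m : ℝ) + 1) ^ 2))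
    (tendsto_linear_mul_zero (abs_gaussCoeff_le m) (1 / ((m : ℝ) + 1)) 0) (fun k => ?_)
  · rw [tsum_mul_left] at h
    simp only [Nat.cast_zero, mul_zero, add_zero, zero_mul] at h
    linarith
  · rw [gaussCoeff_succ_left, gaussCoeff_succ_right]
    have h1 : (m : ℝ) + k + 1 ≠ 0 := by positivity
    have h2 : (m : ℝ) + 1 ≠ 0 := by positivity
    have h3 : (k : ℝ) + 1 ≠ 0 := by positivity
    push_cast
    field_simp
    ring

theorem tendsto_tsum_gaussCoeff : Tendsto (fun m => ∑' k, gaussCoeff m k) atTop (nhds 1) := by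
  have h : Tendsto (fun m => ∑' k, gaussCoeff m k) atTop
      (nhds (∑' k : ℕ, if k = 0 then (1 : ℝ) else 0)) := by
    refine tendsto_tsum_of_dominated_convergence summable_one_div_add_one_sq (fun k => ?_)
      (Eventually.of_forall fun m k => abs_gaussCoeff_le m k)
    cases k with
    | zero => simp [gaussCoeff]
    | succ k =>
      simpa using squeeze_zero_norm (fun m => abs_gaussCoeff_succ_le m k)
        tendsto_one_div_add_atTop_nhds_zero_nat
  simpa using h

theorem tsum_squareCoeff_zero : ∑' k, squareCoeff 0 k = 2 * √2 / π := by
  have hprod : ∀ m : ℕ, ∑' k, gaussCoeff 0 k =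
      (∏ j ∈ Finset.range m, (1 - (1 / 4 : ℝ) ^ 2 / ((j : ℝ) + 1) ^ 2)) *
        ∑' k, gaussCoeff m k := by
    intro m
    induction m with
    | zero => simp
    | succ m ih => rw [ih, tsum_gaussCoeff_succ m, Finset.prod_range_succ, mul_assoc]
  have hsin := Real.tendsto_euler_sin_prod (1 / 4)
  rw [show π * (1 / 4) = π / 4 by ring, Real.sin_pi_div_four] at hsin
  have hpi : π / 4 ≠ 0 := by positivity
  have hlim := ((hsin.const_mul (π / 4)⁻¹).congr
    (fun m => inv_mul_cancel_left₀ hpi _)).mul tendsto_tsum_gaussCoeff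
  have h := tendsto_nhds_unique (tendsto_const_nhds.congr hprod) hlim
  simp only [gaussCoeff_zero] at h
  rw [h]
  field_simp
  norm_num

/-- The hypergeometric weight of the accelerated series. -/
noncomputable def binomWeight (n : ℕ) : ℝ :=
  ((2 * n).centralBinom : ℝ) ^ 2 * (n.centralBinom : ℝ) / 2 ^ (12 * n)

theorem cast_centralBinom_succ (n : ℕ) :
    ((n + 1).centralBinom : ℝ) = 2 * (2 * n + 1) / (n + 1) * n.centralBinom := by
  have h : ((n : ℝ) + 1) * (n + 1).centralBinom = 2 * (2 * n + 1) * n.centralBinom := by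
    exact_mod_cast Nat.succ_mul_centralBinom_succ n
  have : (n : ℝ) + 1 ≠ 0 := by positivity
  field_simp
  linarith

theorem binomWeight_succ (n : ℕ) :
    binomWeight (n + 1) = binomWeight n * ((4 * n + 1) ^ 2 * (4 * n + 3) ^ 2 /
      (512 * ((2 * n + 1) * ((n : ℝ) + 1) ^ 3))) := by
  rw [binomWeight, binomWeight, show 2 * (n + 1) = 2 * n + 1 + 1 by ring,
    cast_centralBinom_succ (2 * n + 1), cast_centralBinom_succ (2 * n), cast_centralBinom_succ n,
    show 12 * (n + 1) = 12 * n + 12 by ring, pow_add]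
  have h1 : (n : ℝ) + 1 ≠ 0 := by positivity
  have h2 : 2 * (n : ℝ) + 1 ≠ 0 := by positivity
  have h3 : 2 * (n : ℝ) + 1 + 1 ≠ 0 := by positivity
  push_cast
  field_simp
  ring

theorem binomWeight_nonneg (n : ℕ) : 0 ≤ binomWeight n := by
  unfold binomWeight
  positivity

theorem sq_mul_binomWeight_le (n : ℕ) : (4 * (n : ℝ) + 1) ^ 2 * binomWeight n ≤ (1 / 2) ^ n := by
  induction n with
  | zero => simp [binomWeight]
  | succ n ih =>
    have hn : (0 : ℝ) ≤ n := by positivity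
    have h : (4 * ((n + 1 : ℕ) : ℝ) + 1) ^ 2 * binomWeight (n + 1) =
        (4 * (n : ℝ) + 1) ^ 2 * binomWeight n *
          ((4 * n + 5) ^ 2 * (4 * n + 3) ^ 2 / (512 * ((2 * n + 1) * ((n : ℝ) + 1) ^ 3))) := by
      rw [binomWeight_succ]
      push_cast
      ring
    have hr : (4 * (n : ℝ) + 5) ^ 2 * (4 * n + 3) ^ 2 / (512 * ((2 * n + 1) * ((n : ℝ) + 1) ^ 3)) ≤
        1 / 2 := by
      have h1 : (4 * (n : ℝ) + 5) * (4 * n + 3) ≤ 16 * (n + 1) ^ 2 := by nlinarith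
      have h2 : ((4 * (n : ℝ) + 5) * (4 * n + 3)) ^ 2 ≤ (16 * (n + 1) ^ 2) ^ 2 := by gcongr
      rw [div_le_iff₀ (by positivity), ← mul_pow]
      refine h2.trans ?_
      have h3 : 0 ≤ (n : ℝ) * (n + 1) ^ 3 := by positivity
      nlinarith
    rw [h, pow_succ]
    exact mul_le_mul ih hr (by positivity) (pow_nonneg (by norm_num) n)

theorem tsum_weighted_squareCoeff_sub (n : ℕ) :
    (4 * (n : ℝ) + 1) ^ 2 * binomWeight n * ∑' k, squareCoeff n k -
      (4 * ((n + 1 : ℕ) : ℝ) + 1) ^ 2 * binomWeight (n + 1) * ∑' k, squareCoeff (n + 1) k =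
    (4 * (n : ℝ) + 1) ^ 2 * binomWeight n *
      (1 - ((n + 1) ^ 2 + 1 / 16) / (2 * (n + 1) * (2 * n + 1))) := by
  have hs := fun n => summable_of_abs_le_one_div_sq (abs_squareCoeff_le n)
  have hG := (tendsto_linear_mul_zero (abs_squareCoeff_le n) (1 / (2 * (n : ℝ) + 1))
    (1 - ((n + 1) ^ 2 + 1 / 16) / (2 * (n + 1) * (2 * n + 1)))).const_mul
      ((4 * (n : ℝ) + 1) ^ 2 * binomWeight n)
  rw [mul_zero] at hG
  rw [← tsum_mul_left, ← tsum_mul_left, tsum_sub_tsum_eq_of_telescoping ((hs n).mul_left _)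
    ((hs (n + 1)).mul_left _) hG (fun k => ?_)]
  · simp [squareCoeff]
  · rw [squareCoeff_succ_left, squareCoeff_succ_right, binomWeight_succ]
    have h1 : (n : ℝ) + k + 1 ≠ 0 := by positivity
    have h2 : (n : ℝ) + 1 ≠ 0 := by positivity
    have h3 : 2 * (n : ℝ) + 1 ≠ 0 := by positivity
    push_cast
    field_simp
    ring

theorem sum_range_binomWeight (N : ℕ) :
    ∑ n ∈ Finset.range N,
      binomWeight n * (3 + 26 * (n : ℝ) + 48 * (n : ℝ) ^ 2 - 96 * (n : ℝ) ^ 3) =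
    ∑' k, squareCoeff 0 k - (4 * (N : ℝ) + 1) ^ 2 * binomWeight N * ∑' k, squareCoeff N k +
      16 * (N : ℝ) ^ 2 * (8 * N + 1) * binomWeight N := by
  induction N with
  | zero => simp [binomWeight]
  | succ n ih =>
    rw [Finset.sum_range_succ, ih]
    have h := tsum_weighted_squareCoeff_sub n
    have hpoly : binomWeight n * (3 + 26 * (n : ℝ) + 48 * (n : ℝ) ^ 2 - 96 * (n : ℝ) ^ 3) =
        (4 * (n : ℝ) + 1) ^ 2 * binomWeight n *
          (1 - ((n + 1) ^ 2 + 1 / 16) / (2 * (n + 1) * (2 * n + 1))) +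
        (16 * ((n + 1 : ℕ) : ℝ) ^ 2 * (8 * (n + 1 : ℕ) + 1) * binomWeight (n + 1) -
          16 * (n : ℝ) ^ 2 * (8 * n + 1) * binomWeight n) := by
      rw [binomWeight_succ]
      have h2 : (n : ℝ) + 1 ≠ 0 := by positivity
      have h3 : 2 * (n : ℝ) + 1 ≠ 0 := by positivity
      push_cast
      field_simp
      ring
    linarith

theorem tendsto_weighted_tsum_squareCoeff :
    Tendsto (fun n : ℕ => (4 * (n : ℝ) + 1) ^ 2 * binomWeight n * ∑' k, squareCoeff n k)
      atTop (nhds 0) := by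
  have h0 : Tendsto (fun n : ℕ => (1 / 2 : ℝ) ^ n * ∑' k : ℕ, 1 / ((k : ℝ) + 1) ^ 2)
      atTop (nhds 0) := by
    simpa only [zero_mul] using (tendsto_pow_atTop_nhds_zero_of_lt_one (r := (1 / 2 : ℝ))
      (by norm_num) (by norm_num)).mul_const (∑' k : ℕ, 1 / ((k : ℝ) + 1) ^ 2)
  refine squeeze_zero_norm (fun n => ?_) h0
  have hz := mul_nonneg (sq_nonneg (4 * (n : ℝ) + 1)) (binomWeight_nonneg n)
  rw [norm_mul, Real.norm_of_nonneg hz]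
  exact mul_le_mul (sq_mul_binomWeight_le n)
    (tsum_of_norm_bounded summable_one_div_add_one_sq.hasSum (abs_squareCoeff_le n))
    (norm_nonneg _) (by positivity)

theorem tendsto_cubic_mul_binomWeight :
    Tendsto (fun n : ℕ => 16 * (n : ℝ) ^ 2 * (8 * n + 1) * binomWeight n) atTop (nhds 0) := by
  have h0 : Tendsto (fun n : ℕ => 8 * ((n : ℝ) * (1 / 2) ^ n) + (1 / 2) ^ n) atTop (nhds 0) := by
    simpa using ((tendsto_self_mul_const_pow_of_lt_one (r := (1 / 2 : ℝ)) (by norm_num)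
      (by norm_num)).const_mul 8).add
      (tendsto_pow_atTop_nhds_zero_of_lt_one (r := (1 / 2 : ℝ)) (by norm_num) (by norm_num))
  have hb := binomWeight_nonneg
  refine squeeze_zero (fun n => mul_nonneg (by positivity) (hb n)) (fun n => ?_) h0
  calc 16 * (n : ℝ) ^ 2 * (8 * n + 1) * binomWeight n
      = (8 * (n : ℝ) + 1) * ((4 * (n : ℝ)) ^ 2 * binomWeight n) := by ring
    _ ≤ (8 * (n : ℝ) + 1) * ((4 * (n : ℝ) + 1) ^ 2 * binomWeight n) := by
        have := hb n
        gcongr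
        linarith
    _ ≤ (8 * (n : ℝ) + 1) * (1 / 2) ^ n := by
        gcongr
        exact sq_mul_binomWeight_le n
    _ = 8 * ((n : ℝ) * (1 / 2) ^ n) + (1 / 2) ^ n := by ring

theorem stmt17 :
    Tendsto (fun N => ∑ n ∈ Finset.range N,
      ((4 * n).choose (2 * n) : ℝ) ^ 2 * ((2 * n).choose n : ℝ) *
        (3 + 26 * (n : ℝ) + 48 * (n : ℝ) ^ 2 - 96 * (n : ℝ) ^ 3) / 2 ^ (12 * n))
      atTop (nhds (2 * Real.sqrt 2 / π)) := by
  have h := (tendsto_weighted_tsum_squareCoeff.const_sub (∑' k, squareCoeff 0 k)).add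
    tendsto_cubic_mul_binomWeight
  rw [sub_zero, add_zero, tsum_squareCoeff_zero] at h
  refine h.congr fun N => ?_
  rw [← tsum_squareCoeff_zero, ← sum_range_binomWeight]
  refine Finset.sum_congr rfl fun n _ => ?_
  rw [binomWeight, Nat.centralBinom, Nat.centralBinom, show 2 * (2 * n) = 4 * n by ring]
  ring
end

section
/- For every real number s with 0 < s < 1, the series ∑_{n=0}^∞ ((s)_n² (1−s)_n² / ((3/2)_n (n!)³)) · (s(1−s) + 2n + 3n²)/4^n converges to sin(πs)/π. -/
open Real Filter

/-- The Pochhammer symbol (rising factorial) `(a)_n = a (a+1) ⋯ (a+n-1)`. -/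
noncomputable def poch (a : ℝ) (n : ℕ) : ℝ := (ascPochhammer ℝ n).eval a

lemma poch_zero (a : ℝ) : poch a 0 = 1 := by simp [poch]

lemma poch_succ (a : ℝ) (n : ℕ) : poch a (n + 1) = poch a n * (a + n) := by
  simp [poch, ascPochhammer_succ_eval]

lemma poch_eq_prod (a : ℝ) (n : ℕ) : poch a n = ∏ j ∈ Finset.range n, (a + j) := by
  induction n with
  | zero => simp [poch_zero]
  | succ n ih => rw [poch_succ, ih, Finset.prod_range_succ]

lemma poch_pos {a : ℝ} (ha : 0 < a) (n : ℕ) : 0 < poch a n := by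
  rw [poch_eq_prod]
  exact Finset.prod_pos fun j _ => by positivity

lemma poch_three_halves (n : ℕ) :
    poch (3 / 2) n * (n.factorial : ℝ) * 4 ^ n = ((2 * n + 1).factorial : ℝ) := by
  induction n with
  | zero => simp [poch_zero]
  | succ n ih =>
    rw [show 2 * (n + 1) + 1 = (2 * n + 1 + 1) + 1 by ring, Nat.factorial_succ (2 * n + 1 + 1),
      Nat.factorial_succ (2 * n + 1), Nat.factorial_succ n, poch_succ]
    push_cast
    rw [← ih]
    ring

/-- The product `(s)_m (1 - s)_m`. -/
noncomputable def pochRefl (s : ℝ) (m : ℕ) : ℝ := poch s m * poch (1 - s) m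

lemma pochRefl_succ (s : ℝ) (m : ℕ) :
    pochRefl s (m + 1) = pochRefl s m * (s * (1 - s) + m * (m + 1)) := by
  simp only [pochRefl, poch_succ]
  ring

lemma pochRefl_pos {s : ℝ} (hs0 : 0 < s) (hs1 : s < 1) (m : ℕ) : 0 < pochRefl s m :=
  mul_pos (poch_pos hs0 m) (poch_pos (by linarith) m)

lemma pochRefl_le {s : ℝ} (hs0 : 0 < s) (hs1 : s < 1) (m : ℕ) :
    pochRefl s m ≤ (m.factorial : ℝ) ^ 2 := by
  induction m with
  | zero => simp [pochRefl, poch_zero]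
  | succ m ih =>
    have hs : 0 < s * (1 - s) := mul_pos hs0 (by linarith)
    rw [pochRefl_succ, Nat.factorial_succ]
    push_cast
    rw [mul_pow, mul_comm]
    gcongr
    · exact (pochRefl_pos hs0 hs1 m).le
    · nlinarith [(Nat.cast_nonneg m : (0 : ℝ) ≤ m), sq_nonneg (s - 1 / 2)]

lemma tendsto_pochRefl_div {s : ℝ} (hs0 : 0 < s) (hs1 : s < 1) :
    Tendsto (fun k : ℕ => pochRefl s (k + 1) / (k.factorial * (k + 1).factorial : ℝ)) atTop
      (nhds (Real.sin (π * s) / π)) := by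
  have hne : Real.Gamma s * Real.Gamma (1 - s) ≠ 0 :=
    (mul_pos (Real.Gamma_pos_of_pos hs0) (Real.Gamma_pos_of_pos (by linarith))).ne'
  have h := ((Real.GammaSeq_tendsto_Gamma s).mul (Real.GammaSeq_tendsto_Gamma (1 - s))).inv₀ hne
  rw [Real.Gamma_mul_Gamma_one_sub, inv_div] at h
  have h2 := (tendsto_natCast_div_add_atTop (1 : ℝ)).mul h
  rw [one_mul] at h2
  refine h2.congr' ?_
  filter_upwards [eventually_gt_atTop 0] with k hk
  have hk' : (0 : ℝ) < k := by exact_mod_cast hk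
  have h1 := (poch_pos hs0 (k + 1)).ne'
  have h3 := (poch_pos (a := 1 - s) (by linarith) (k + 1)).ne'
  have hf : (k.factorial : ℝ) ≠ 0 := by positivity
  have hpow : (k : ℝ) ^ s * (k : ℝ) ^ (1 - s) = k := by
    rw [← Real.rpow_add hk']
    simp
  rw [Real.GammaSeq, Real.GammaSeq, ← poch_eq_prod, ← poch_eq_prod, pochRefl,
    Nat.factorial_succ, div_mul_div_comm,
    show (k : ℝ) ^ s * k.factorial * ((k : ℝ) ^ (1 - s) * k.factorial)
      = ((k : ℝ) ^ s * (k : ℝ) ^ (1 - s)) * k.factorial ^ 2 by ring, hpow]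
  push_cast
  field_simp

/-- The common hypergeometric kernel of the WZ pair. -/
noncomputable def wzKernel (s : ℝ) (n k : ℕ) : ℝ :=
  pochRefl s n * pochRefl s (n + k) /
    (n.factorial * (n + k).factorial * (2 * n + k + 1).factorial : ℝ)

/-- The member of the WZ pair that is summed over `n`. -/
noncomputable def wzG (s : ℝ) (n k : ℕ) : ℝ :=
  wzKernel s n k * (s * (1 - s) + (n + k) * (n + k + 1) + n * (2 * n + k + 1))

/-- The certificate companion of `wzG`. -/
noncomputable def wzF (s : ℝ) (n k : ℕ) : ℝ := wzKernel s n k * (n * (2 * n + k + 1))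

lemma wzKernel_succ_right (s : ℝ) (n k : ℕ) :
    wzKernel s n (k + 1) = wzKernel s n k *
      ((s * (1 - s) + (n + k) * (n + k + 1)) / ((n + k + 1) * (2 * n + k + 2))) := by
  rw [wzKernel, wzKernel, ← add_assoc n k 1, pochRefl_succ,
    show 2 * n + (k + 1) + 1 = (2 * n + k + 1) + 1 by ring, Nat.factorial_succ (2 * n + k + 1),
    Nat.factorial_succ (n + k)]
  push_cast
  field_simp
  ring

lemma wzKernel_succ_left (s : ℝ) (n k : ℕ) :
    wzKernel s (n + 1) k = wzKernel s n k *
      ((s * (1 - s) + n * (n + 1)) * (s * (1 - s) + (n + k) * (n + k + 1)) /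
        ((n + 1) * (n + k + 1) * (2 * n + k + 2) * (2 * n + k + 3))) := by
  rw [wzKernel, wzKernel, show n + 1 + k = n + k + 1 by ring, pochRefl_succ, pochRefl_succ,
    show 2 * (n + 1) + k + 1 = (2 * n + k + 1) + 1 + 1 by ring,
    Nat.factorial_succ (2 * n + k + 1 + 1), Nat.factorial_succ (2 * n + k + 1),
    Nat.factorial_succ (n + k), Nat.factorial_succ n]
  push_cast
  field_simp
  ring

lemma wz_relation (s : ℝ) (n k : ℕ) :
    wzF s (n + 1) k - wzF s n k = wzG s n (k + 1) - wzG s n k := by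
  rw [wzF, wzF, wzG, wzG, wzKernel_succ_left, wzKernel_succ_right]
  push_cast
  field_simp
  ring

lemma sum_wzG_succ (s : ℝ) (N k : ℕ) :
    ∑ n ∈ Finset.range N, wzG s n (k + 1) = ∑ n ∈ Finset.range N, wzG s n k + wzF s N k := by
  induction N with
  | zero => simp [wzF]
  | succ N ih =>
    rw [Finset.sum_range_succ, Finset.sum_range_succ, ih]
    linarith [wz_relation s N k]

lemma sum_wzG_eq (s : ℝ) (N k : ℕ) :
    ∑ n ∈ Finset.range N, wzG s n k =
      ∑ n ∈ Finset.range N, wzG s n 0 + ∑ j ∈ Finset.range k, wzF s N j := by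
  induction k with
  | zero => simp
  | succ k ih => rw [sum_wzG_succ, ih, Finset.sum_range_succ, add_assoc]

lemma wzKernel_pos {s : ℝ} (hs0 : 0 < s) (hs1 : s < 1) (n k : ℕ) : 0 < wzKernel s n k := by
  have h1 := pochRefl_pos hs0 hs1 n
  have h2 := pochRefl_pos hs0 hs1 (n + k)
  unfold wzKernel
  positivity

lemma wzF_nonneg {s : ℝ} (hs0 : 0 < s) (hs1 : s < 1) (n k : ℕ) : 0 ≤ wzF s n k := by
  have := wzKernel_pos hs0 hs1 n k
  unfold wzF
  positivity

lemma wzF_le {s : ℝ} (hs0 : 0 < s) (hs1 : s < 1) (n k : ℕ) :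
    wzF s n k ≤ n * (n.factorial * (n + k).factorial / (2 * n + k).factorial : ℝ) := by
  have h2 := (pochRefl_pos hs0 hs1 (n + k)).le
  calc wzF s n k ≤ ((n.factorial : ℝ) ^ 2 * ((n + k).factorial : ℝ) ^ 2 /
        (n.factorial * (n + k).factorial * (2 * n + k + 1).factorial : ℝ)) *
          (n * (2 * n + k + 1)) := by
        unfold wzF wzKernel
        gcongr
        · exact pochRefl_le hs0 hs1 n
        · exact pochRefl_le hs0 hs1 (n + k)
    _ = _ := by
        rw [Nat.factorial_succ (2 * n + k)]
        push_cast
        field_simp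

lemma sum_factorial_ratio (m k : ℕ) :
    ∑ j ∈ Finset.range k, ((m + 2 : ℕ) : ℝ) *
      ((m + 2).factorial * (m + 2 + j).factorial / (2 * (m + 2) + j).factorial : ℝ) =
    (m + 2) / (m + 1) * ((m + 2).factorial * (m + 2).factorial / (2 * m + 3).factorial : ℝ) -
    (m + 2) / (m + 1) *
      ((m + 2).factorial * (m + 2 + k).factorial / (2 * m + 3 + k).factorial : ℝ) := by
  induction k with
  | zero => simp
  | succ k ih =>
    rw [Finset.sum_range_succ, ih, ← add_assoc (m + 2) k 1, ← add_assoc (2 * m + 3) k 1,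
      show 2 * (m + 2) + k = 2 * m + 3 + k + 1 by ring, Nat.factorial_succ (2 * m + 3 + k),
      Nat.factorial_succ (m + 2 + k)]
    push_cast
    field_simp
    ring

lemma factorial_sq_mul_le (m : ℕ) :
    (m + 2).factorial * (m + 2).factorial * (m + 1) ≤ (2 * m + 3).factorial := by
  induction m with
  | zero => decide
  | succ m ih =>
    rw [show 2 * (m + 1) + 3 = 2 * m + 3 + 1 + 1 by ring, Nat.factorial_succ (2 * m + 3 + 1),
      Nat.factorial_succ (2 * m + 3), show m + 1 + 2 = m + 2 + 1 by ring,
      Nat.factorial_succ (m + 2)]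
    have h : (m + 3) * (m + 3) * (m + 2) ≤ (m + 1) * ((2 * m + 5) * (2 * m + 4)) := by
      nlinarith [Nat.zero_le (m ^ 3), Nat.zero_le (m ^ 2)]
    calc _ = (m + 2).factorial * (m + 2).factorial * ((m + 3) * (m + 3) * (m + 2)) := by ring
      _ ≤ (m + 2).factorial * (m + 2).factorial * ((m + 1) * ((2 * m + 5) * (2 * m + 4))) := by
        gcongr
      _ = ((2 * m + 5) * (2 * m + 4)) *
          ((m + 2).factorial * (m + 2).factorial * (m + 1)) := by ring
      _ ≤ ((2 * m + 5) * (2 * m + 4)) * (2 * m + 3).factorial := by gcongr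
      _ = _ := by ring

lemma sum_wzF_le {s : ℝ} (hs0 : 0 < s) (hs1 : s < 1) (m k : ℕ) :
    ∑ j ∈ Finset.range k, wzF s (m + 2) j ≤ 2 / (m + 1) := by
  refine (Finset.sum_le_sum fun j _ => wzF_le hs0 hs1 (m + 2) j).trans ?_
  rw [sum_factorial_ratio]
  refine (sub_le_self _ (by positivity)).trans ?_
  have h : ((m + 2).factorial * (m + 2).factorial * (m + 1) : ℝ) ≤ (2 * m + 3).factorial := by
    exact_mod_cast factorial_sq_mul_le m
  have hm : (m + 2 : ℝ) / (m + 1) ≤ 2 := by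
    rw [div_le_iff₀ (by positivity)]
    linarith [(Nat.cast_nonneg m : (0 : ℝ) ≤ m)]
  have h' : ((m + 2).factorial * (m + 2).factorial / (2 * m + 3).factorial : ℝ) ≤ 1 / (m + 1) := by
    rw [div_le_div_iff₀ (by positivity) (by positivity)]
    linarith
  calc _ ≤ (2 : ℝ) * (1 / (m + 1)) := by gcongr
    _ = _ := by ring

lemma wzG_zero_left (s : ℝ) (k : ℕ) :
    wzG s 0 k = pochRefl s (k + 1) / (k.factorial * (k + 1).factorial : ℝ) := by
  rw [wzG, wzKernel, pochRefl_succ]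
  simp [pochRefl, poch_zero]
  ring

lemma wzG_succ_le {s : ℝ} (hs0 : 0 < s) (hs1 : s < 1) (n k : ℕ) :
    wzG s (n + 1) k ≤ 3 * (pochRefl s (n + 1) / (n + 1).factorial) *
      wzG s 0 (n + 1 + k) * (1 / (k + 1)) := by
  have hx : 0 < s * (1 - s) := mul_pos hs0 (by linarith)
  have h1 := pochRefl_pos hs0 hs1 (n + 1)
  have h2 := pochRefl_pos hs0 hs1 (n + 1 + k)
  have hpoly : s * (1 - s) + ((n + 1 : ℕ) + k) * ((n + 1 : ℕ) + k + 1) +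
      (n + 1 : ℕ) * (2 * (n + 1 : ℕ) + k + 1) ≤
      3 * (s * (1 - s) + ((n + 1 : ℕ) + k) * ((n + 1 : ℕ) + k + 1)) := by
    push_cast
    have : (0 : ℝ) ≤ n * k := by positivity
    nlinarith [sq_nonneg (k : ℝ), (Nat.cast_nonneg n : (0 : ℝ) ≤ n),
      (Nat.cast_nonneg k : (0 : ℝ) ≤ k)]
  have hfac : ((n + 1 + k + 1).factorial : ℝ) * (k + 1) ≤ (2 * (n + 1) + k + 1).factorial := by
    have h : (n + 1 + k + 1).factorial * (k + 1) ≤ (2 * (n + 1) + k + 1).factorial := by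
      calc _ ≤ (n + 1 + k + 1).factorial * (n + 1 + k + 1 + 1) := by gcongr; omega
        _ = (n + 1 + k + 1 + 1).factorial := by rw [Nat.factorial_succ (n + 1 + k + 1)]; ring
        _ ≤ _ := Nat.factorial_le (by omega)
    exact_mod_cast h
  calc wzG s (n + 1) k ≤ pochRefl s (n + 1) * pochRefl s (n + 1 + k) /
        ((n + 1).factorial * (n + 1 + k).factorial * ((n + 1 + k + 1).factorial * (k + 1)) : ℝ) *
        (3 * (s * (1 - s) + ((n + 1 : ℕ) + k) * ((n + 1 : ℕ) + k + 1))) := by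
        unfold wzG wzKernel
        gcongr
    _ = _ := by
        rw [wzG_zero_left, pochRefl_succ s (n + 1 + k)]
        push_cast
        field_simp

lemma tendsto_wzG_succ {s : ℝ} (hs0 : 0 < s) (hs1 : s < 1) (n : ℕ) :
    Tendsto (fun k => wzG s (n + 1) k) atTop (nhds 0) := by
  have hx : 0 < s * (1 - s) := mul_pos hs0 (by linarith)
  have h0 : Tendsto (fun k => wzG s 0 (n + 1 + k)) atTop (nhds (Real.sin (π * s) / π)) := by
    have h := (tendsto_pochRefl_div hs0 hs1).comp (tendsto_add_atTop_nat (n + 1))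
    refine h.congr fun k => ?_
    rw [Function.comp_apply, wzG_zero_left, add_comm k]
  have h := (h0.const_mul (3 * (pochRefl s (n + 1) / (n + 1).factorial))).mul
    (tendsto_one_div_add_atTop_nhds_zero_nat (𝕜 := ℝ))
  rw [mul_zero] at h
  refine squeeze_zero (fun k => ?_) (fun k => wzG_succ_le hs0 hs1 n k) h
  have := wzKernel_pos hs0 hs1 (n + 1) k
  unfold wzG
  positivity

lemma tendsto_sum_wzG {s : ℝ} (hs0 : 0 < s) (hs1 : s < 1) (N : ℕ) :
    Tendsto (fun k => ∑ n ∈ Finset.range (N + 1), wzG s n k) atTop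
      (nhds (Real.sin (π * s) / π)) := by
  simp_rw [Finset.sum_range_succ' _ N]
  have h := (tendsto_finsetSum (Finset.range N) fun n _ => tendsto_wzG_succ hs0 hs1 n).add
    ((tendsto_pochRefl_div hs0 hs1).congr fun k => (wzG_zero_left s k).symm)
  simpa using h

lemma wzG_zero_right (s : ℝ) (n : ℕ) :
    (poch s n ^ 2 * poch (1 - s) n ^ 2 / (poch (3 / 2) n * (n.factorial : ℝ) ^ 3)) *
      (s * (1 - s) + 2 * (n : ℝ) + 3 * (n : ℝ) ^ 2) / 4 ^ n = wzG s n 0 := by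
  have h := (poch_pos (a := 3 / 2) (by norm_num) n).ne'
  rw [wzG, wzKernel, add_zero, add_zero, ← poch_three_halves, pochRefl]
  push_cast
  field_simp
  ring

theorem stmt18 (s : ℝ) (hs0 : 0 < s) (hs1 : s < 1) :
    Tendsto (fun N => ∑ n ∈ Finset.range N,
      (poch s n ^ 2 * poch (1 - s) n ^ 2 / (poch (3 / 2) n * (n.factorial : ℝ) ^ 3)) *
        (s * (1 - s) + 2 * (n : ℝ) + 3 * (n : ℝ) ^ 2) / 4 ^ n)
      atTop (nhds (Real.sin (π * s) / π)) := by
  simp_rw [wzG_zero_right]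
  rw [← tendsto_add_atTop_iff_nat 2]
  set L := Real.sin (π * s) / π
  have hlow (m : ℕ) : L - 2 / (m + 1) ≤ ∑ n ∈ Finset.range (m + 2), wzG s n 0 := by
    rw [sub_le_iff_le_add]
    refine le_of_tendsto' (tendsto_sum_wzG hs0 hs1 (m + 1)) fun k => ?_
    rw [sum_wzG_eq]
    gcongr
    exact sum_wzF_le hs0 hs1 m k
  have hupp (m : ℕ) : ∑ n ∈ Finset.range (m + 2), wzG s n 0 ≤ L := by
    refine ge_of_tendsto' (tendsto_sum_wzG hs0 hs1 (m + 1)) fun k => ?_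
    rw [sum_wzG_eq s (m + 1 + 1) k]
    exact le_add_of_nonneg_right (Finset.sum_nonneg fun j _ => wzF_nonneg hs0 hs1 _ j)
  refine tendsto_of_tendsto_of_tendsto_of_le_of_le ?_ tendsto_const_nhds hlow hupp
  have h := (tendsto_one_div_add_atTop_nhds_zero_nat (𝕜 := ℝ)).const_mul 2
  simpa [div_eq_mul_inv] using h.const_sub L
end
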